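/- Let (X,T,μ) be a dynamical system with μ a T-invariant probability measure, suppose the system is ergodic, and let α = {A_1,…,A_m} be a finite measurable partition of X. Then for μ-almost every x ∈ X the limit Ĥ(x,α) = lim_{l→∞} limsup_{n→∞} Ĥ_l(φ_α(x)^n) exists and equals h_μ(T,α). -/

import Mathlib

open Filter MeasureTheory
open scoped ENNReal

/-- The string of the first `n` symbols of an infinite sequence. -/
def pref {A : Type*} (ω : ℕ → A) (n : ℕ) : List A := (List.range n).map ω

/-- The finite set of `l`-blocks occurring in the string `s`. -/
def blocks {A : Type*} [DecidableEq A] (l : ℕ) (s : List A) : Finset (List A) :=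
  (Finset.range (s.length - l + 1)).image fun i => (s.drop i).take l

/-- Empirical frequency `P(s,w)`: number of occurrences of `w` as a block of consecutive
symbols of `s`, divided by `|s| - |w| + 1`. -/
noncomputable def empFreq {A : Type*} [DecidableEq A] (s : List A) (w : List A) : ℝ :=
  (((Finset.range (s.length - w.length + 1)).filter
      fun i => (s.drop i).take w.length = w).card : ℝ) / ((s.length - w.length + 1 : ℕ) : ℝ)

/-- The `l`-th empirical entropy `Ĥ_l(s) = -(1/l) Σ_w P(s,w) log₂ P(s,w)`
(words `w` with `P(s,w) = 0` contribute `0`, so it suffices to sum over occurring blocks). -/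
noncomputable def empEnt {A : Type*} [DecidableEq A] (l : ℕ) (s : List A) : ℝ :=
  -(1 / (l : ℝ)) * ∑ w ∈ blocks l s, empFreq s w * Real.logb 2 (empFreq s w)

/-- The sequence whose limit is the entropy `h_μ(T,α)` of `T` relative to the finite
measurable partition `α`. -/
noncomputable def relEntSeq {X : Type*} [MeasurableSpace X] (μ : Measure X)
    (T : X → X) {m : ℕ} (α : Fin m → Set X) (n : ℕ) : ℝ :=
  (1 / (n : ℝ)) * ∑ w : Fin n → Fin m,
    -((μ (⋂ i : Fin n, T^[(i : ℕ)] ⁻¹' α (w i))).toReal *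
      Real.logb 2 ((μ (⋂ i : Fin n, T^[(i : ℕ)] ⁻¹' α (w i))).toReal))

/-- The maximum of `0` and of the first `N` Birkhoff sums of `g`, defined recursively. -/
noncomputable def maxBirkhoffSum {X : Type*} (T : X → X) (g : X → ℝ) : ℕ → X → ℝ
  | 0 => fun _ => 0
  | N + 1 => fun x => max 0 (g x + maxBirkhoffSum T g N (T x))

lemma maxBirkhoffSum_nonneg {X : Type*} (T : X → X) (g : X → ℝ) (N : ℕ) (x : X) :
    0 ≤ maxBirkhoffSum T g N x := by
  cases N with
  | zero => exact le_rfl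
  | succ N => exact le_max_left _ _

lemma maxBirkhoffSum_le_succ {X : Type*} (T : X → X) (g : X → ℝ) (N : ℕ) (x : X) :
    maxBirkhoffSum T g N x ≤ maxBirkhoffSum T g (N + 1) x := by
  induction N generalizing x with
  | zero => exact maxBirkhoffSum_nonneg T g 1 x
  | succ N ih =>
    exact max_le_max le_rfl (add_le_add le_rfl (ih (T x)))

lemma birkhoffSum_le_maxBirkhoffSum {X : Type*} (T : X → X) (g : X → ℝ) (N : ℕ) (x : X) :
    birkhoffSum T g N x ≤ maxBirkhoffSum T g N x := by
  induction N generalizing x with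
  | zero => simp [maxBirkhoffSum]
  | succ N ih =>
    rw [birkhoffSum_succ']
    exact le_max_of_le_right (add_le_add le_rfl (ih (T x)))

section Ergodic

variable {X : Type*} [MeasurableSpace X] {μ : Measure X} {T : X → X} {g : X → ℝ}

lemma measurable_maxBirkhoffSum (hT : Measurable T) (hg : Measurable g) (N : ℕ) :
    Measurable (maxBirkhoffSum T g N) := by
  induction N with
  | zero => exact measurable_const
  | succ N ih => exact measurable_const.max (hg.add (ih.comp hT))

lemma integrable_maxBirkhoffSum (hT : MeasurePreserving T μ μ) (hg : Integrable g μ) (N : ℕ) :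
    Integrable (maxBirkhoffSum T g N) μ := by
  induction N with
  | zero => exact integrable_zero _ _ _
  | succ N ih =>
    exact (integrable_zero _ _ _).sup (hg.add (hT.integrable_comp_of_integrable ih))

/-- The maximal ergodic inequality. -/
lemma integral_indicator_maxBirkhoffSum_nonneg (hT : MeasurePreserving T μ μ)
    (hgm : Measurable g) (hg : Integrable g μ) (N : ℕ) :
    0 ≤ ∫ x, {x | 0 < maxBirkhoffSum T g (N + 1) x}.indicator g x ∂μ := by
  have hM := measurable_maxBirkhoffSum hT.measurable hgm
  have hMi := integrable_maxBirkhoffSum hT hg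
  have hcomp : ∫ x, maxBirkhoffSum T g N (T x) ∂μ = ∫ x, maxBirkhoffSum T g N x ∂μ := by
    conv_rhs => rw [← hT.map_eq]
    rw [integral_map hT.aemeasurable (hM N).aestronglyMeasurable]
  calc (0 : ℝ) ≤ ∫ x, maxBirkhoffSum T g (N + 1) x ∂μ - ∫ x, maxBirkhoffSum T g N (T x) ∂μ := by
        rw [hcomp, sub_nonneg]
        exact integral_mono (hMi N) (hMi (N + 1)) (maxBirkhoffSum_le_succ T g N)
    _ = ∫ x, (maxBirkhoffSum T g (N + 1) x - maxBirkhoffSum T g N (T x)) ∂μ :=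
        (integral_sub (hMi (N + 1)) (hT.integrable_comp_of_integrable (hMi N))).symm
    _ ≤ _ := by
        refine integral_mono ((hMi (N + 1)).sub (hT.integrable_comp_of_integrable (hMi N)))
          (hg.indicator (measurableSet_lt measurable_const (hM (N + 1)))) fun x => ?_
        by_cases hx : 0 < maxBirkhoffSum T g (N + 1) x
        · rw [Set.indicator_of_mem (show x ∈ {x | 0 < maxBirkhoffSum T g (N + 1) x} from hx)]
          have h : maxBirkhoffSum T g (N + 1) x = g x + maxBirkhoffSum T g N (T x) := by
            rcases max_choice 0 (g x + maxBirkhoffSum T g N (T x)) with h | h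
            · exact absurd h hx.ne'
            · exact h
          simp [h]
        · rw [Set.indicator_of_notMem (show x ∉ {x | 0 < maxBirkhoffSum T g (N + 1) x} from hx)]
          have := maxBirkhoffSum_nonneg T g N (T x)
          simp only
          linarith

/-- If an integrable function has negative integral, its Birkhoff sums are almost everywhere
bounded above. -/
lemma Ergodic.ae_bddAbove_birkhoffSum (hT : Ergodic T μ) (hgm : Measurable g)
    (hg : Integrable g μ) (hneg : ∫ x, g x ∂μ < 0) :
    ∀ᵐ x ∂μ, ∃ K : ℕ, ∀ n, birkhoffSum T g n x ≤ K := by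
  set D : Set X := {x | ∀ K : ℕ, ∃ n, (K : ℝ) < birkhoffSum T g n x} with hD
  have hS (n : ℕ) : Measurable (birkhoffSum T g n) :=
    Finset.measurable_sum _ fun k _ => hgm.comp (hT.measurable.iterate k)
  have hDm : MeasurableSet D := by
    simp only [hD, Set.ofPred_forall, Set.ofPred_exists]
    exact .iInter fun K => .iUnion fun n => measurableSet_lt measurable_const (hS n)
  have hDinv : T ⁻¹' D = D := by
    ext x
    simp only [hD, Set.mem_preimage, Set.mem_ofPred_eq]
    constructor
    · intro h K
      obtain ⟨K', hK'⟩ := exists_nat_ge (K - g x)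
      obtain ⟨n, hn⟩ := h K'
      refine ⟨n + 1, ?_⟩
      rw [birkhoffSum_succ']
      linarith
    · intro h K
      obtain ⟨K', hK'⟩ := exists_nat_ge (K + |g x|)
      obtain ⟨n, hn⟩ := h K'
      cases n with
      | zero =>
        rw [birkhoffSum_zero] at hn
        exact absurd hn (not_lt.2 K'.cast_nonneg)
      | succ n =>
        rw [birkhoffSum_succ'] at hn
        exact ⟨n, by linarith [le_abs_self (g x)]⟩
  rcases hT.toPreErgodic.ae_mem_or_ae_notMem hDm hDinv with h | h
  · exfalso
    have hlim : Tendsto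
        (fun N => ∫ x, {x | 0 < maxBirkhoffSum T g (N + 1) x}.indicator g x ∂μ)
        atTop (nhds (∫ x, g x ∂μ)) := by
      refine tendsto_integral_of_dominated_convergence (fun x => |g x|) (fun N => ?_) hg.abs
        (fun N => .of_forall fun x => ?_) ?_
      · exact (hgm.indicator (measurableSet_lt measurable_const
          (measurable_maxBirkhoffSum hT.measurable hgm _))).aestronglyMeasurable
      · exact norm_indicator_le_norm_self g x
      · filter_upwards [h] with x hx
        obtain ⟨n, hn⟩ := hx 0
        refine tendsto_const_nhds.congr' ?_
        filter_upwards [eventually_ge_atTop n] with N hN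
        refine (Set.indicator_of_mem ?_ g).symm
        have h1 := birkhoffSum_le_maxBirkhoffSum T g n x
        have h2 := monotone_nat_of_le_succ (fun k => maxBirkhoffSum_le_succ T g k x)
          (hN.trans N.le_succ)
        simp only [Nat.cast_zero] at hn
        exact hn.trans_le (h1.trans h2)
    exact hneg.not_ge (ge_of_tendsto' hlim fun N =>
      integral_indicator_maxBirkhoffSum_nonneg hT.toMeasurePreserving hgm hg N)
  · filter_upwards [h] with x hx
    simpa [hD] using hx

/-- Upper half of the pointwise ergodic theorem. -/
lemma Ergodic.ae_eventually_birkhoffAverage_lt [IsProbabilityMeasure μ] (hT : Ergodic T μ)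
    (hgm : Measurable g) (hg : Integrable g μ) {b : ℝ} (hb : ∫ x, g x ∂μ < b) :
    ∀ᵐ x ∂μ, ∀ᶠ n in atTop, birkhoffAverage ℝ T g n x < b := by
  obtain ⟨a, ha, hab⟩ := exists_between hb
  have hneg : ∫ x, (g x - a) ∂μ < 0 := by
    rw [integral_sub hg (integrable_const a)]
    simpa using ha
  filter_upwards [hT.ae_bddAbove_birkhoffSum (hgm.sub_const a)
    (hg.sub (integrable_const a)) hneg] with x hx
  obtain ⟨K, hK⟩ := hx
  have hlim : Tendsto (fun n : ℕ => a + (K : ℝ) / n) atTop (nhds a) := by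
    simpa using (tendsto_const_div_atTop_nhds_zero_nat (K : ℝ)).const_add a
  filter_upwards [hlim.eventually (gt_mem_nhds hab), eventually_gt_atTop 0] with n hn hn0
  refine lt_of_le_of_lt ?_ hn
  have hn0 : (0 : ℝ) < n := Nat.cast_pos.2 hn0
  have h := hK n
  simp only [birkhoffSum, Finset.sum_sub_distrib, Finset.sum_const, Finset.card_range,
    nsmul_eq_mul] at h
  rw [birkhoffAverage, birkhoffSum, smul_eq_mul, inv_mul_le_iff₀ hn0]
  field_simp
  linarith

/-- Birkhoff's pointwise ergodic theorem for ergodic probability-preserving maps. -/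
lemma Ergodic.ae_tendsto_birkhoffAverage [IsProbabilityMeasure μ] (hT : Ergodic T μ)
    (hgm : Measurable g) (hg : Integrable g μ) :
    ∀ᵐ x ∂μ, Tendsto (fun n => birkhoffAverage ℝ T g n x) atTop (nhds (∫ x, g x ∂μ)) := by
  obtain ⟨u, -, hu, hulim⟩ := exists_seq_strictAnti_tendsto (0 : ℝ)
  have hup : ∀ᵐ x ∂μ, ∀ k, ∀ᶠ n in atTop,
      birkhoffAverage ℝ T g n x < ∫ x, g x ∂μ + u k :=
    ae_all_iff.2 fun k => hT.ae_eventually_birkhoffAverage_lt hgm hg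
      (lt_add_of_pos_right _ (hu k))
  have hlow : ∀ᵐ x ∂μ, ∀ k, ∀ᶠ n in atTop,
      birkhoffAverage ℝ T (-g) n x < ∫ x, (-g) x ∂μ + u k :=
    ae_all_iff.2 fun k => hT.ae_eventually_birkhoffAverage_lt hgm.neg hg.neg
      (lt_add_of_pos_right _ (hu k))
  filter_upwards [hup, hlow] with x hx hx'
  rw [Metric.tendsto_nhds]
  intro ε hε
  obtain ⟨k, hk⟩ := (hulim.eventually (gt_mem_nhds hε)).exists
  filter_upwards [hx k, hx' k] with n h1 h2
  simp only [birkhoffAverage_neg, Pi.neg_apply, integral_neg] at h2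
  rw [Real.dist_eq, abs_lt]
  constructor <;> linarith

end Ergodic

section Words

variable {A : Type*}

lemma length_pref (ω : ℕ → A) (n : ℕ) : (pref ω n).length = n := by
  simp [pref]

lemma take_drop_pref (ω : ℕ → A) {n l i : ℕ} (h : i + l ≤ n) :
    ((pref ω n).drop i).take l = List.ofFn fun j : Fin l => ω (i + j) := by
  refine List.ext_getElem ?_ fun k h1 h2 => ?_
  · simp [pref]
    omega
  · simp [pref]

variable [DecidableEq A]

lemma empFreq_pref (ω : ℕ → A) {n l : ℕ} (h : l ≤ n) (w : Fin l → A) :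
    empFreq (pref ω n) (List.ofFn w) =
      (((Finset.range (n - l + 1)).filter fun i => ∀ j : Fin l, ω (i + j) = w j).card : ℝ) /
        ((n - l + 1 : ℕ) : ℝ) := by
  rw [empFreq, length_pref, List.length_ofFn]
  congr 3
  refine Finset.filter_congr fun i hi => ?_
  rw [Finset.mem_range] at hi
  rw [take_drop_pref ω (by omega), List.ofFn_injective.eq_iff, funext_iff]

lemma empEnt_pref [Fintype A] (ω : ℕ → A) {n l : ℕ} (h : l ≤ n) :
    empEnt l (pref ω n) = -(1 / (l : ℝ)) * ∑ w : Fin l → A,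
      empFreq (pref ω n) (List.ofFn w) * Real.logb 2 (empFreq (pref ω n) (List.ofFn w)) := by
  classical
  rw [empEnt, ← Finset.sum_image (s := Finset.univ) (g := fun w : Fin l → A => List.ofFn w)
    (f := fun u => empFreq (pref ω n) u * Real.logb 2 (empFreq (pref ω n) u))
    List.ofFn_injective.injOn]
  congr 1
  refine Finset.sum_subset (fun u hu => ?_) fun u hu hu' => ?_
  · simp only [blocks, length_pref, Finset.mem_image, Finset.mem_range] at hu
    obtain ⟨i, hi, rfl⟩ := hu
    rw [take_drop_pref ω (by omega)]
    exact Finset.mem_image_of_mem _ (Finset.mem_univ _)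
  · obtain ⟨w, -, rfl⟩ := Finset.mem_image.1 hu
    have hzero : empFreq (pref ω n) (List.ofFn w) = 0 := by
      rw [empFreq, Finset.filter_eq_empty_iff.2, Finset.card_empty, Nat.cast_zero, zero_div]
      intro i hi hiw
      refine hu' (Finset.mem_image.2 ⟨i, ?_, ?_⟩)
      · simpa using hi
      · simpa using hiw
    simp [hzero]

end Words

/-- If `(X,T,μ)` is ergodic and `α` is a finite measurable partition of `X`, then for
`μ`-almost every `x` the limit `Ĥ(x,α) = lim_l limsup_n Ĥ_l(φ_α(x)ⁿ)` exists and equals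
`h_μ(T,α)` (given as the limit `hα` of the relative entropy sequence). -/
theorem stmt_11 {X : Type*} [MeasurableSpace X]
    (μ : Measure X) [IsProbabilityMeasure μ]
    (T : X → X) (herg : Ergodic T μ)
    (m : ℕ) (hm : 0 < m) (α : Fin m → Set X)
    (hαmeas : ∀ j, MeasurableSet (α j))
    (hαdisj : ∀ i j, i ≠ j → Disjoint (α i) (α j))
    (hαcover : (⋃ j, α j) = Set.univ)
    (φ : X → ℕ → Fin m)
    (hφ : ∀ x (i : ℕ) (j : Fin m), T^[i] x ∈ α j ↔ φ x i = j)
    (hα : ℝ) (hent : Filter.Tendsto (relEntSeq μ T α) Filter.atTop (nhds hα)) :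
    ∀ᵐ x ∂μ, Filter.Tendsto
      (fun l : ℕ => Filter.atTop.limsup fun n : ℕ => empEnt l (pref (φ x) n))
      Filter.atTop (nhds hα) := by
  have hcyl (l : ℕ) (w : Fin l → Fin m) :
      MeasurableSet (⋂ i : Fin l, T^[(i : ℕ)] ⁻¹' α (w i)) :=
    .iInter fun i => herg.measurable.iterate i (hαmeas (w i))
  have hbirk : ∀ᵐ x ∂μ, ∀ (l : ℕ) (w : Fin l → Fin m), Tendsto
      (fun n => birkhoffAverage ℝ T
        ((⋂ i : Fin l, T^[(i : ℕ)] ⁻¹' α (w i)).indicator fun _ => (1 : ℝ)) n x)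
      atTop (nhds (μ (⋂ i : Fin l, T^[(i : ℕ)] ⁻¹' α (w i))).toReal) := by
    refine ae_all_iff.2 fun l => ae_all_iff.2 fun w => ?_
    have h := herg.ae_tendsto_birkhoffAverage (measurable_const.indicator (hcyl l w))
      ((integrable_const (1 : ℝ)).indicator (hcyl l w))
    rwa [integral_indicator_const _ (hcyl l w), smul_eq_mul, mul_one] at h
  filter_upwards [hbirk] with x hx
  refine hent.congr fun l => ?_
  have hfreq (w : Fin l → Fin m) : Tendsto
      (fun n => empFreq (pref (φ x) n) (List.ofFn w)) atTop
      (nhds (μ (⋂ i : Fin l, T^[(i : ℕ)] ⁻¹' α (w i))).toReal) := by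
    refine ((hx l w).comp ((tendsto_add_atTop_nat 1).comp
      (tendsto_sub_atTop_nat l))).congr' ?_
    filter_upwards [eventually_ge_atTop l] with n hn
    classical
    rw [empFreq_pref (φ x) hn w]
    have hmem (k : ℕ) : T^[k] x ∈ (⋂ i : Fin l, T^[(i : ℕ)] ⁻¹' α (w i)) ↔
        ∀ j : Fin l, φ x (k + j) = w j := by
      simp only [Set.mem_iInter, Set.mem_preimage, ← hφ, ← Function.iterate_add_apply,
        add_comm k]
    simp only [Function.comp_apply, birkhoffAverage, birkhoffSum, Set.indicator_apply, hmem,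
      Finset.sum_boole, smul_eq_mul]
    rw [div_eq_inv_mul]
  have hlim : Tendsto (fun n => empEnt l (pref (φ x) n)) atTop (nhds (relEntSeq μ T α l)) := by
    have hcont : Continuous fun t : ℝ => t * Real.logb 2 t := by
      simpa only [Real.logb, mul_div_assoc] using Real.continuous_mul_log.div_const (Real.log 2)
    have h := (tendsto_finsetSum Finset.univ fun w _ =>
      (hcont.tendsto _).comp (hfreq w)).const_mul (-(1 / (l : ℝ)))
    rw [relEntSeq, Finset.sum_neg_distrib, mul_neg, ← neg_mul]
    refine h.congr' ?_
    filter_upwards [eventually_ge_atTop l] with n hn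
    exact (empEnt_pref (φ x) hn).symm
  exact hlim.limsup_eq.symm
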